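/- For (T,φ), (T',φ') ∈ OP_Γ one has σ(T,φ) ⊆ σ(T',φ') if and only if (T,φ) ≤ (T',φ'); consequently (T,φ) ↦ σ(T,φ) is an isomorphism from the poset OP_Γ onto the poset of the cones σ(T,φ), (T,φ) ∈ OP_Γ, ordered by inclusion. -/

import Mathlib

/-!
Serre-style finite graphs: a vertex type `V`, an oriented-edge type `E` with a
fixed-point-free involution `inv` (edge reversal) and source/target maps `s, t`
with `s (inv e) = t e`.  An unoriented edge is an `inv`-orbit `{e, inv e}`;
subsets of unoriented edges are encoded as `inv`-closed subsets of `E`, and an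
orientation of a spanning subgraph `Γ∖T` is encoded by the set `O` of its
positively oriented edges.  1-chains with coefficients in `A` are encoded as
functions `c : E → A` with `c (inv e) = - c e` (so that `(c, e⃗) = c e` for the
standard bilinear form).
-/

structure SerreGraph where
  V : Type
  E : Type
  [fintypeV : Fintype V]
  [fintypeE : Fintype E]
  [decEqV : DecidableEq V]
  [decEqE : DecidableEq E]
  inv : E → E
  s : E → V
  t : E → V
  inv_inv : ∀ e, inv (inv e) = e
  inv_ne : ∀ e, inv e ≠ e
  s_inv : ∀ e, s (inv e) = t e

attribute [instance] SerreGraph.fintypeV SerreGraph.fintypeE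
attribute [instance] SerreGraph.decEqV SerreGraph.decEqE

namespace SerreGraph

variable (Γ : SerreGraph)

/-- Reachability between vertices in the spanning subgraph whose allowed oriented
edges are those in `A`. -/
def Reach (A : Set Γ.E) : Γ.V → Γ.V → Prop :=
  Relation.ReflTransGen (fun a b => ∃ e ∈ A, Γ.s e = a ∧ Γ.t e = b)

/-- The number of connected components of the spanning subgraph with allowed
oriented edges `A`. -/
noncomputable def numComponents (A : Set Γ.E) : ℕ :=
  Nat.card (Quot (fun a b : Γ.V => ∃ e ∈ A, Γ.s e = a ∧ Γ.t e = b))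

/-- The set of separating (oriented) edges: removing the underlying unoriented
edge increases the number of connected components. -/
def Esep : Set Γ.E :=
  {e | Γ.numComponents Set.univ < Γ.numComponents {f | f ≠ e ∧ f ≠ Γ.inv e}}

/-- `T` encodes a set of unoriented edges. -/
def InvClosed (T : Set Γ.E) : Prop := ∀ e, e ∈ T ↔ Γ.inv e ∈ T

/-- `O` is (the set of positively oriented edges of) an orientation of `Γ∖T`. -/
def IsOrientation (T O : Set Γ.E) : Prop :=
  (∀ e ∈ O, e ∉ T) ∧ ∀ e, e ∉ T → (e ∈ O ↔ Γ.inv e ∉ O)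

/-- A totally cyclic orientation of `Γ∖T`: an orientation such that there is no
vertex set `W` which is nonempty and proper inside some connected component of
`Γ∖T` and such that all edges of `Γ∖T` crossing the boundary of `W` are oriented
out of `W` (this is the componentwise condition of the paper). -/
def IsTotallyCyclic (T O : Set Γ.E) : Prop :=
  Γ.IsOrientation T O ∧
    ¬ ∃ W : Set Γ.V, (∃ v ∈ W, ∃ w ∈ Wᶜ, Γ.Reach Tᶜ v w) ∧
        ∀ e ∈ O, Γ.t e ∈ W → Γ.s e ∈ W

/-- `γ` is (the set of positively oriented edges of) an oriented circuit of `Γ`: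
a cyclic subgraph (connected, first Betti number one, no separating edges)
together with a totally cyclic orientation; equivalently a directed cycle:
each incident vertex has exactly one outgoing and one incoming edge in `γ`,
and the support is connected. -/
def IsCircuit (γ : Finset Γ.E) : Prop :=
  γ.Nonempty ∧ (∀ e ∈ γ, Γ.inv e ∉ γ) ∧
    (∀ v ∈ γ.image Γ.s ∪ γ.image Γ.t, ∃! e, e ∈ γ ∧ Γ.s e = v) ∧
    (∀ v ∈ γ.image Γ.s ∪ γ.image Γ.t, ∃! e, e ∈ γ ∧ Γ.t e = v) ∧
    ∀ e ∈ γ, ∀ f ∈ γ, Γ.Reach ((↑γ : Set Γ.E) ∪ Γ.inv '' ↑γ) (Γ.s e) (Γ.s f)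

/-- The class `[γ] ∈ H₁(Γ,ℤ)` of an oriented circuit. -/
def circChainZ (γ : Finset Γ.E) : Γ.E → ℤ :=
  fun e => if e ∈ γ then 1 else if Γ.inv e ∈ γ then -1 else 0

/-- The class `[γ] ∈ H₁(Γ,ℝ)` of an oriented circuit. -/
noncomputable def circChainR (γ : Finset Γ.E) : Γ.E → ℝ :=
  fun e => (Γ.circChainZ γ e : ℝ)

/-- `Cir_φ(Γ∖T)`: oriented circuits of `Γ∖T` compatibly oriented with the
orientation with positive edges `O`. -/
def Cir (T O : Set Γ.E) : Set (Finset Γ.E) :=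
  {γ | Γ.IsCircuit γ ∧ (∀ e ∈ γ, e ∈ O) ∧ ∀ e ∈ γ, e ∉ T}

/-- `c` is a 1-cycle: a skew 1-chain with vanishing boundary, i.e. an element of
`H₁(Γ,A)`. -/
def IsCycle {A : Type*} [AddCommGroup A] (c : Γ.E → A) : Prop :=
  (∀ e, c (Γ.inv e) = - c e) ∧
    ∀ v, ∑ e ∈ Finset.univ.filter (fun e => Γ.t e = v), c e = 0

/-- An element of `H₁(Γ∖T, A) ⊆ H₁(Γ,A)`: a cycle supported on edges not in `T`. -/
def IsCycleOn {A : Type*} [AddCommGroup A] (T : Set Γ.E) (c : Γ.E → A) : Prop :=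
  Γ.IsCycle c ∧ ∀ e ∈ T, c e = 0

/-- The standard positive definite bilinear form on `C⃗₁(Γ,ℝ)`, for which
`(c, e⃗) = c e`. -/
noncomputable def pair (c c' : Γ.E → ℝ) : ℝ := (∑ e, c e * c' e) / 2

/-- The first Betti number `b₁(Γ) = dim_ℝ H₁(Γ,ℝ)`. -/
noncomputable def b1 : ℕ :=
  Module.finrank ℝ (Submodule.span ℝ {c : Γ.E → ℝ | Γ.IsCycle c})

/-- `b₁(Γ∖T) = dim_ℝ H₁(Γ∖T,ℝ)`. -/
noncomputable def b1Sub (T : Set Γ.E) : ℕ :=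
  Module.finrank ℝ (Submodule.span ℝ {c : Γ.E → ℝ | Γ.IsCycleOn T c})

/-- The cone `σ(T,φ) ⊆ H₁(Γ,ℝ)` of the cographic fan associated to a pair
`(T, O)` with `O` an orientation of `Γ∖T`. -/
def sigmaCone (T O : Set Γ.E) : Set (Γ.E → ℝ) :=
  {v | Γ.IsCycle v ∧ (∀ e ∈ O, 0 ≤ v e) ∧ ∀ e ∈ T, v e = 0}

/-- The poset `OP_Γ` of totally cyclic orientations: pairs `(T, O)` with `T` a
set of unoriented edges and `O` a totally cyclic orientation of `Γ∖T`. -/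
def OP : Set (Set Γ.E × Set Γ.E) :=
  {p | Γ.InvClosed p.1 ∧ Γ.IsTotallyCyclic p.1 p.2}

/-- The order on `OP_Γ`: `(T',φ') ≤ (T,φ)` iff `T' ⊇ T` and `φ'` is the
restriction of `φ`. -/
def OPle (p q : Set Γ.E × Set Γ.E) : Prop :=
  q.1 ⊆ p.1 ∧ p.2 = q.2 ∩ p.1ᶜ

/-- `H₁(Γ,ℤ)` viewed as the set of lattice points of `H₁(Γ,ℝ)`. -/
def H1Z : Set (Γ.E → ℝ) := {c | Γ.IsCycle c ∧ ∀ e, ∃ n : ℤ, c e = (n : ℝ)}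

/-- The Voronoi polytope `Vor_Γ ⊆ H₁(Γ,ℝ)`. -/
def voronoi : Set (Γ.E → ℝ) :=
  {v | Γ.IsCycle v ∧ ∀ l ∈ Γ.H1Z, Γ.pair v v ≤ Γ.pair (v - l) (v - l)}

/-- A (exposed) face of the Voronoi polytope. -/
def IsVorFace (F : Set (Γ.E → ℝ)) : Prop :=
  ∃ l : (Γ.E → ℝ) →ₗ[ℝ] ℝ, F = {v | v ∈ Γ.voronoi ∧ ∀ w ∈ Γ.voronoi, l w ≤ l v}

/-- The face `F(T,φ)` of the Voronoi polytope associated to `(T,O) ∈ OP_Γ`. -/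
def vorFace (T O : Set Γ.E) : Set (Γ.E → ℝ) :=
  {v | v ∈ Γ.voronoi ∧ ∀ γ ∈ Γ.Cir T O,
      Γ.pair v (Γ.circChainR γ) = Γ.pair (Γ.circChainR γ) (Γ.circChainR γ) / 2}

end SerreGraph


namespace SerreGraph

variable {Γ : SerreGraph}

lemma t_inv (e : Γ.E) : Γ.t (Γ.inv e) = Γ.s e := by
  rw [← Γ.s_inv, Γ.inv_inv]

variable (Γ) in
/-- The elementary skew chain of an oriented edge. -/
def edgeChain (e : Γ.E) : Γ.E → ℝ :=
  fun f => (if f = e then 1 else 0) - if f = Γ.inv e then 1 else 0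

lemma edgeChain_inv_apply (e f : Γ.E) : Γ.edgeChain e (Γ.inv f) = -Γ.edgeChain e f := by
  have h₁ : Γ.inv f = e ↔ f = Γ.inv e :=
    ⟨fun h => by rw [← h, Γ.inv_inv], fun h => by rw [h, Γ.inv_inv]⟩
  have h₂ : Γ.inv f = Γ.inv e ↔ f = e :=
    ⟨fun h => by rw [← Γ.inv_inv f, h, Γ.inv_inv], fun h => by rw [h]⟩
  simp [edgeChain, h₁, h₂]

lemma sum_edgeChain (e : Γ.E) (v : Γ.V) :
    ∑ f ∈ Finset.univ.filter (fun f => Γ.t f = v), Γ.edgeChain e f =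
      (if Γ.t e = v then 1 else 0) - if Γ.s e = v then 1 else 0 := by
  simp [edgeChain, Finset.sum_sub_distrib, Finset.sum_ite_eq', t_inv]

lemma edgeChain_self (e : Γ.E) : Γ.edgeChain e e = 1 := by
  simp [edgeChain, (Γ.inv_ne e).symm]

lemma IsOrientation.edgeChain_nonneg {T O : Set Γ.E} (hO : Γ.IsOrientation T O) {e f : Γ.E}
    (he : e ∈ O) (hf : f ∈ O) : 0 ≤ Γ.edgeChain e f := by
  have hne : f ≠ Γ.inv e := by
    rintro rfl
    exact (hO.2 e (hO.1 e he)).1 he hf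
  simp only [edgeChain, hne, if_false]
  split_ifs <;> norm_num

lemma IsOrientation.edgeChain_eq_zero {T O : Set Γ.E} (hO : Γ.IsOrientation T O)
    (hT : Γ.InvClosed T) {e f : Γ.E} (he : e ∈ O) (hf : f ∈ T) : Γ.edgeChain e f = 0 := by
  have h₁ : f ≠ e := by
    rintro rfl
    exact hO.1 f he hf
  have h₂ : f ≠ Γ.inv e := by
    rintro rfl
    exact hO.1 e he ((hT e).2 hf)
  simp [edgeChain, h₁, h₂]

/-- A directed path from `a` to `b` in `O` yields a nonnegative chain with boundary `b - a`. -/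
lemma IsOrientation.exists_chain_of_reach {T O : Set Γ.E} (hO : Γ.IsOrientation T O)
    (hT : Γ.InvClosed T) {a b : Γ.V} (h : Γ.Reach O a b) :
    ∃ c : Γ.E → ℝ, (∀ e, c (Γ.inv e) = -c e) ∧
      (∀ v, ∑ e ∈ Finset.univ.filter (fun e => Γ.t e = v), c e =
        (if b = v then 1 else 0) - if a = v then 1 else 0) ∧
      (∀ e ∈ O, 0 ≤ c e) ∧ ∀ e ∈ T, c e = 0 := by
  induction h with
  | refl => exact ⟨0, by simp⟩
  | tail _ hstep ih =>
    obtain ⟨e, he, rfl, rfl⟩ := hstep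
    obtain ⟨c, hskew, hbd, hnonneg, hzero⟩ := ih
    refine ⟨c + Γ.edgeChain e, fun f => ?_, fun v => ?_, fun f hf => ?_, fun f hf => ?_⟩
    · simp only [Pi.add_apply, hskew, edgeChain_inv_apply]
      ring
    · simp only [Pi.add_apply, Finset.sum_add_distrib, hbd, sum_edgeChain]
      ring
    · exact add_nonneg (hnonneg f hf) (hO.edgeChain_nonneg he hf)
    · simp [hzero f hf, hO.edgeChain_eq_zero hT he hf]

lemma IsTotallyCyclic.reach {T O : Set Γ.E} (hO : Γ.IsTotallyCyclic T O) {e : Γ.E}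
    (he : e ∈ O) : Γ.Reach O (Γ.t e) (Γ.s e) := by
  by_contra hne
  refine hO.2 ⟨{x | Γ.Reach O x (Γ.s e)}, ⟨Γ.s e, .refl, Γ.t e, hne, ?_⟩, fun f hf h => ?_⟩
  · exact .single ⟨e, hO.1.1 e he, rfl, rfl⟩
  · exact Relation.ReflTransGen.head ⟨f, hf, rfl, rfl⟩ h

/-- Every positively oriented edge is positive on some element of the cone. -/
lemma IsTotallyCyclic.exists_mem_sigmaCone_pos {T O : Set Γ.E} (hO : Γ.IsTotallyCyclic T O)
    (hT : Γ.InvClosed T) {e : Γ.E} (he : e ∈ O) : ∃ v ∈ Γ.sigmaCone T O, 0 < v e := by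
  obtain ⟨c, hskew, hbd, hnonneg, hzero⟩ := hO.1.exists_chain_of_reach hT (hO.reach he)
  refine ⟨c + Γ.edgeChain e, ⟨⟨fun f => ?_, fun v => ?_⟩, fun f hf => ?_, fun f hf => ?_⟩, ?_⟩
  · simp only [Pi.add_apply, hskew, edgeChain_inv_apply]
    ring
  · simp only [Pi.add_apply, Finset.sum_add_distrib, hbd, sum_edgeChain]
    ring
  · exact add_nonneg (hnonneg f hf) (hO.1.edgeChain_nonneg he hf)
  · simp [hzero f hf, hO.1.edgeChain_eq_zero hT he hf]
  · simpa [edgeChain_self] using add_pos_of_nonneg_of_pos (hnonneg e he) one_pos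

lemma IsOrientation.mem_or_inv_mem {T O : Set Γ.E} (hO : Γ.IsOrientation T O) {e : Γ.E}
    (he : e ∉ T) : e ∈ O ∨ Γ.inv e ∈ O := by
  by_contra! h
  exact h.1 ((hO.2 e he).2 h.2)

lemma OPle.sigmaCone_subset {p q : Set Γ.E × Set Γ.E} (h : Γ.OPle p q) :
    Γ.sigmaCone p.1 p.2 ⊆ Γ.sigmaCone q.1 q.2 := by
  rintro v ⟨hv, hnonneg, hzero⟩
  refine ⟨hv, fun e he => ?_, fun e he => hzero e (h.1 he)⟩
  by_cases hp : e ∈ p.1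
  · exact (hzero e hp).ge
  · exact hnonneg e (h.2 ▸ ⟨he, hp⟩)

lemma OPle_of_sigmaCone_subset {p q : Set Γ.E × Set Γ.E} (hp : p ∈ Γ.OP) (hq : q ∈ Γ.OP)
    (h : Γ.sigmaCone p.1 p.2 ⊆ Γ.sigmaCone q.1 q.2) : Γ.OPle p q := by
  have hdisj : ∀ e ∈ p.2, e ∉ q.1 := fun e he heq => by
    obtain ⟨v, hv, hpos⟩ := hp.2.exists_mem_sigmaCone_pos hp.1 he
    exact hpos.ne' ((h hv).2.2 e heq)
  have hsub : p.2 ⊆ q.2 := fun e he => by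
    obtain ⟨v, hv, hpos⟩ := hp.2.exists_mem_sigmaCone_pos hp.1 he
    refine (hq.2.1.mem_or_inv_mem (hdisj e he)).resolve_right fun hinv => ?_
    have := (h hv).2.1 _ hinv
    rw [hv.1.1 e] at this
    linarith
  refine ⟨fun e he => ?_, Set.Subset.antisymm (fun e he => ⟨hsub he, hp.2.1.1 e he⟩) ?_⟩
  · by_contra hne
    rcases hp.2.1.mem_or_inv_mem hne with h' | h'
    · exact hdisj e h' he
    · exact hdisj _ h' ((hq.1 e).1 he)
  · rintro e ⟨he, hne⟩
    refine (hp.2.1.mem_or_inv_mem hne).resolve_right fun hinv => ?_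
    exact (hq.2.1.2 e (hq.2.1.1 e he)).1 he (hsub hinv)

lemma sigmaCone_subset_iff {p q : Set Γ.E × Set Γ.E} (hp : p ∈ Γ.OP) (hq : q ∈ Γ.OP) :
    Γ.sigmaCone p.1 p.2 ⊆ Γ.sigmaCone q.1 q.2 ↔ Γ.OPle p q :=
  ⟨OPle_of_sigmaCone_subset hp hq, OPle.sigmaCone_subset⟩

lemma OPle.antisymm {p q : Set Γ.E × Set Γ.E} (h : Γ.OPle p q) (h' : Γ.OPle q p) : p = q :=
  Prod.ext (h'.1.antisymm h.1) <| Set.Subset.antisymm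
    (fun _ he => (h.2 ▸ he : _ ∈ q.2 ∩ p.1ᶜ).1) (fun _ he => (h'.2 ▸ he : _ ∈ p.2 ∩ q.1ᶜ).1)

end SerreGraph

/-- For `(T,φ), (T',φ') ∈ OP_Γ`: `σ(T,φ) ⊆ σ(T',φ')` iff
`(T,φ) ≤ (T',φ')`; consequently `(T,φ) ↦ σ(T,φ)` is an isomorphism from `OP_Γ`
onto the poset of the cones `σ(T,φ)` ordered by inclusion (in particular it is
injective). -/
theorem stmt8 (Γ : SerreGraph) :
    (∀ p ∈ Γ.OP, ∀ q ∈ Γ.OP,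
      (Γ.sigmaCone p.1 p.2 ⊆ Γ.sigmaCone q.1 q.2 ↔ Γ.OPle p q)) ∧
    ∀ p ∈ Γ.OP, ∀ q ∈ Γ.OP,
      Γ.sigmaCone p.1 p.2 = Γ.sigmaCone q.1 q.2 → p = q := by
  refine ⟨fun p hp q hq => SerreGraph.sigmaCone_subset_iff hp hq, fun p hp q hq h => ?_⟩
  exact ((SerreGraph.sigmaCone_subset_iff hp hq).1 h.subset).antisymm
    ((SerreGraph.sigmaCone_subset_iff hq hp).1 h.superset)
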